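/- Let σ^∨ ⊆ M_ℝ be a full-dimensional strongly convex rational polyhedral cone and n a positive integer. Then the union over all facets F of σ^∨ and all lattice points f ∈ F ∩ (1/n)M of the translated cones (σ^∨ − f) covers exactly the complement of −Int(σ^∨) in (1/n)M: that is, a point λ ∈ (1/n)M satisfies λ ∉ ⋃_{F facet, f ∈ F ∩ (1/n)M} (σ^∨ − f) if and only if −λ ∈ Int(σ^∨). -/

import Mathlib

open Set Pointwise

noncomputable section

/-- The standard dot product pairing on `Fin d → ℝ`. -/
def dotR {d : ℕ} (m v : Fin d → ℝ) : ℝ := ∑ i, m i * v i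

/-- The cast of an integer lattice vector to a real vector. -/
def zCast {d : ℕ} (u : Fin d → ℤ) : Fin d → ℝ := fun i => (u i : ℝ)

/-- The convex cone generated by finitely many vectors `v 0, …, v (s-1)`:
all nonnegative real combinations. -/
def coneOf {d s : ℕ} (v : Fin s → Fin d → ℝ) : Set (Fin d → ℝ) :=
  {x | ∃ c : Fin s → ℝ, (∀ i, 0 ≤ c i) ∧ x = ∑ i, c i • v i}

/-- The dual cone of a set `σ`: all `m` pairing nonnegatively with every element of `σ`. -/
def dualCone {d : ℕ} (σ : Set (Fin d → ℝ)) : Set (Fin d → ℝ) :=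
  {m | ∀ v ∈ σ, 0 ≤ dotR m v}

/-- A facet of a cone `C ⊆ ℝ^d`: an exposed face cut out by a supporting linear
functional, of dimension `d - 1`. -/
def IsFacetOf {d : ℕ} (F C : Set (Fin d → ℝ)) : Prop :=
  (∃ m : Fin d → ℝ, m ≠ 0 ∧ (∀ x ∈ C, 0 ≤ dotR m x) ∧ F = {x ∈ C | dotR m x = 0}) ∧
  Module.finrank ℝ (Submodule.span ℝ F) = d - 1

/-- If `m` is nonnegative on the family `v` and `w` is negative somewhere on `v` but vanishes wherever
`m` does, then some `m + t • w` with `t ≥ 0` is nonnegative on `v` and vanishes at a point of `v`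
where `m` does not. -/
lemma exists_add_smul_nonneg_of_neg {K E ι : Type*} [Field K] [LinearOrder K]
    [IsStrictOrderedRing K] [AddCommGroup E] [Module K E] [Finite ι] (v : ι → E)
    (m w : Module.Dual K E) (hm : ∀ i, 0 ≤ m (v i)) (hw : ∀ i, m (v i) = 0 → w (v i) = 0)
    (hneg : ∃ i, w (v i) < 0) :
    ∃ t : K, 0 ≤ t ∧ (∀ i, 0 ≤ (m + t • w) (v i)) ∧
      ∃ j, m (v j) ≠ 0 ∧ (m + t • w) (v j) = 0 := by
  obtain ⟨j, hj, hmin⟩ := Set.exists_min_image {i | w (v i) < 0}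
    (fun i => m (v i) / -w (v i)) (Set.toFinite _) hneg
  have hj' : w (v j) < 0 := hj
  have ht : 0 ≤ m (v j) / -w (v j) := div_nonneg (hm j) (by linarith)
  refine ⟨m (v j) / -w (v j), ht, fun i => ?_, j, fun h => hj'.ne (hw j h), ?_⟩
  · simp only [LinearMap.add_apply, LinearMap.smul_apply, smul_eq_mul]
    by_cases hi : w (v i) < 0
    · have h := hmin i hi
      rw [le_div_iff₀ (by linarith)] at h
      linarith
    · exact add_nonneg (hm i) (mul_nonneg ht (not_lt.mp hi))
  · simp only [LinearMap.add_apply, LinearMap.smul_apply, smul_eq_mul]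
    have := hj'.ne
    field_simp
    ring

/-- If a nonzero functional is nonnegative on a finite spanning family and nonpositive at `p`, then
there is such a functional whose kernel is spanned by members of the family. -/
lemma exists_nonneg_ker_eq_span {K E ι : Type*} [Field K] [LinearOrder K]
    [IsStrictOrderedRing K] [AddCommGroup E] [Module K E] [Finite ι] (v : ι → E)
    (hv : Submodule.span K (Set.range v) = ⊤) (p : E)
    (h : ∃ m : Module.Dual K E, m ≠ 0 ∧ (∀ i, 0 ≤ m (v i)) ∧ m p ≤ 0) :
    ∃ m : Module.Dual K E, m ≠ 0 ∧ (∀ i, 0 ≤ m (v i)) ∧ m p ≤ 0 ∧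
      LinearMap.ker m = Submodule.span K (v '' {i | m (v i) = 0}) := by
  have exists_ne (f : Module.Dual K E) (hf : f ≠ 0) : ∃ i, f (v i) ≠ 0 := by
    by_contra! hcon
    refine hf (LinearMap.ext_on_range hv fun i => ?_)
    simpa using hcon i
  obtain ⟨I, ⟨m, ⟨hm0, hm, hmp⟩, rfl⟩, hmax⟩ := Set.Finite.exists_maximal
    (s := (fun m : Module.Dual K E => {i | m (v i) = 0}) ''
      {m | m ≠ 0 ∧ (∀ i, 0 ≤ m (v i)) ∧ m p ≤ 0})
    (Set.toFinite _) (Set.Nonempty.image _ h)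
  refine ⟨m, hm0, hm, hmp, le_antisymm (fun x hx => ?_) ?_⟩
  swap
  · rw [Submodule.span_le]
    rintro _ ⟨i, hi, rfl⟩
    exact hi
  by_contra hxW
  obtain ⟨w₀, hw₀x, hw₀⟩ := Submodule.exists_le_ker_of_notMem hxW
  have hw₀v : ∀ i, m (v i) = 0 → w₀ (v i) = 0 := fun i hi =>
    hw₀ (Submodule.subset_span ⟨i, hi, rfl⟩)
  have hmx : m x = 0 := hx
  obtain ⟨w, hwx, hwv, hwp, hneg⟩ : ∃ w : Module.Dual K E, w x ≠ 0 ∧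
      (∀ i, m (v i) = 0 → w (v i) = 0) ∧ w p ≤ 0 ∧ ∃ i, w (v i) < 0 := by
    rcases hmp.lt_or_eq with hlt | heq
    · set w₁ := w₀ - (w₀ p / m p) • m with hw₁
      have h₁x : w₁ x ≠ 0 := by simpa [hw₁, hmx] using hw₀x
      have h₁v : ∀ i, m (v i) = 0 → w₁ (v i) = 0 := fun i hi => by simp [hw₁, hi, hw₀v i hi]
      have h₁p : w₁ p = 0 := by simp [hw₁, hlt.ne]
      obtain ⟨i, hi⟩ := exists_ne w₁ (by rintro h0; simp [h0] at h₁x)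
      rcases hi.lt_or_gt with hi | hi
      · exact ⟨w₁, h₁x, h₁v, h₁p.le, i, hi⟩
      · exact ⟨-w₁, by simpa using h₁x, by simpa using h₁v, by simp [h₁p], i, by simpa using hi⟩
    · obtain ⟨w₁, h₁x, h₁v, h₁p⟩ : ∃ w : Module.Dual K E, w x ≠ 0 ∧
          (∀ i, m (v i) = 0 → w (v i) = 0) ∧ w p ≤ 0 := by
        rcases le_total (w₀ p) 0 with h0 | h0
        · exact ⟨w₀, hw₀x, hw₀v, h0⟩
        · exact ⟨-w₀, by simpa using hw₀x, by simpa using hw₀v, by simpa using h0⟩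
      obtain ⟨i, hi⟩ := exists_ne m hm0
      refine ⟨w₁ - ((w₁ (v i) + 1) / m (v i)) • m, by simpa [hmx] using h₁x,
        fun j hj => by simp [hj, h₁v j hj], by simpa [heq] using h₁p, i, ?_⟩
      simp [hi]
  obtain ⟨t, ht, hnn, j, hj, hj0⟩ := exists_add_smul_nonneg_of_neg v m w hm hwv hneg
  have hne : m + t • w ≠ 0 := by
    intro h0
    have h1 : (m + t • w) x = 0 := by simp [h0]
    have ht0 : t = 0 := by simpa [hmx, hwx] using h1
    exact hm0 (by simpa [ht0] using h0)
  have hp : (m + t • w) p ≤ 0 := by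
    simpa using add_nonpos hmp (mul_nonpos_of_nonneg_of_nonpos ht hwp)
  exact hj (hmax ⟨m + t • w, ⟨hne, hnn, hp⟩, rfl⟩
    (fun i (hi : m (v i) = 0) => by simp [hi, hwv i hi]) hj0)

lemma dotR_eq_dotProduct {d : ℕ} (m v : Fin d → ℝ) : dotR m v = m ⬝ᵥ v := rfl

lemma exists_dotR_eq {d : ℕ} (m : Module.Dual ℝ (Fin d → ℝ)) :
    ∃ u : Fin d → ℝ, ∀ x, dotR u x = m x :=
  ⟨(dotProductEquiv ℝ (Fin d)).symm m, fun x =>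
    DFunLike.congr_fun ((dotProductEquiv ℝ (Fin d)).apply_symm_apply m) x⟩

/-- A nonzero functional nonnegative on a set is positive on its interior. -/
lemma dotR_pos_of_mem_interior {d : ℕ} {C : Set (Fin d → ℝ)} {m p : Fin d → ℝ} (hm : m ≠ 0)
    (hC : ∀ x ∈ C, 0 ≤ dotR m x) (hp : p ∈ interior C) : 0 < dotR m p := by
  have htend : Filter.Tendsto (fun ε : ℝ => p - ε • m) (nhdsWithin 0 (Set.Ioi 0)) (nhds p) := by
    have : Continuous fun ε : ℝ => p - ε • m := by fun_prop
    simpa using (this.tendsto 0).mono_left nhdsWithin_le_nhds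
  obtain ⟨ε, hε, hε0⟩ := ((htend.eventually (mem_interior_iff_mem_nhds.mp hp)).and
    self_mem_nhdsWithin).exists
  have h := hC _ hε
  have hmm : 0 < m ⬝ᵥ m := by
    simpa using Matrix.dotProduct_star_self_pos_iff.mpr hm
  rw [dotR_eq_dotProduct, dotProduct_sub, dotProduct_smul, smul_eq_mul] at h
  have := mul_pos (Set.mem_Ioi.mp hε0) hmm
  rw [dotR_eq_dotProduct]
  linarith

section coneOf

variable {d s : ℕ} (v : Fin s → Fin d → ℝ)

lemma mem_coneOf (i : Fin s) : v i ∈ coneOf v :=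
  ⟨Pi.single i 1, fun j => by by_cases h : j = i <;> simp [h],
    by simp [Pi.single_apply]⟩

lemma zero_mem_coneOf : (0 : Fin d → ℝ) ∈ coneOf v := ⟨0, by simp, by simp⟩

variable {v}

lemma add_mem_coneOf {x y : Fin d → ℝ} (hx : x ∈ coneOf v) (hy : y ∈ coneOf v) :
    x + y ∈ coneOf v := by
  obtain ⟨a, ha, rfl⟩ := hx
  obtain ⟨b, hb, rfl⟩ := hy
  exact ⟨a + b, fun i => add_nonneg (ha i) (hb i), by simp [add_smul, Finset.sum_add_distrib]⟩

lemma smul_mem_coneOf {x : Fin d → ℝ} {t : ℝ} (ht : 0 ≤ t) (hx : x ∈ coneOf v) :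
    t • x ∈ coneOf v := by
  obtain ⟨a, ha, rfl⟩ := hx
  exact ⟨t • a, fun i => mul_nonneg ht (ha i), by simp [Finset.smul_sum, smul_smul]⟩

lemma sum_smul_mem_coneOf (S : Finset (Fin s)) {c : Fin s → ℝ} (hc : ∀ i ∈ S, 0 ≤ c i) :
    ∑ i ∈ S, c i • v i ∈ coneOf v :=
  Finset.sum_induction _ (· ∈ coneOf v) (fun _ _ => add_mem_coneOf) (zero_mem_coneOf v)
    fun i hi => smul_mem_coneOf (hc i hi) (mem_coneOf v i)

variable (v)

lemma convex_coneOf : Convex ℝ (coneOf v) := fun _ hx _ hy _ _ ha hb _ =>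
  add_mem_coneOf (smul_mem_coneOf ha hx) (smul_mem_coneOf hb hy)

lemma span_coneOf : Submodule.span ℝ (coneOf v) = Submodule.span ℝ (Set.range v) := by
  refine le_antisymm (Submodule.span_le.mpr ?_) (Submodule.span_mono ?_)
  · rintro _ ⟨c, -, rfl⟩
    exact Submodule.sum_mem _ fun i _ => Submodule.smul_mem _ _ (Submodule.subset_span ⟨i, rfl⟩)
  · rintro _ ⟨i, rfl⟩
    exact mem_coneOf v i

variable {v}

lemma nonneg_of_mem_coneOf {m : Module.Dual ℝ (Fin d → ℝ)} (hm : ∀ i, 0 ≤ m (v i))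
    {x : Fin d → ℝ} (hx : x ∈ coneOf v) : 0 ≤ m x := by
  obtain ⟨c, hc, rfl⟩ := hx
  simpa using Finset.sum_nonneg fun i _ => mul_nonneg (hc i) (hm i)

lemma exists_supporting_of_notMem_interior_coneOf
    (hv : Submodule.span ℝ (coneOf v) = ⊤) {p : Fin d → ℝ} (hp : p ∉ interior (coneOf v)) :
    ∃ m : Module.Dual ℝ (Fin d → ℝ), m ≠ 0 ∧ (∀ i, 0 ≤ m (v i)) ∧ m p ≤ 0 := by
  have hconv := convex_coneOf v
  have hne : (interior (coneOf v)).Nonempty := by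
    rw [hconv.interior_nonempty_iff_affineSpan_eq_top,
      ← Set.insert_eq_of_mem (zero_mem_coneOf v)]
    refine SetLike.coe_injective ?_
    rw [affineSpan_insert_zero, hv]
    rfl
  obtain ⟨f, hf⟩ := geometric_hahn_banach_open_point hconv.interior isOpen_interior hp
  have hle : ∀ x ∈ coneOf v, f x ≤ f p := by
    intro x hx
    have hx' : x ∈ closure (interior (coneOf v)) := by
      rw [hconv.closure_interior_eq_closure_of_nonempty_interior hne]
      exact subset_closure hx
    exact closure_minimal (fun a ha => (hf a ha).le)
      (isClosed_le f.continuous continuous_const) hx'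
  have hp0 : 0 ≤ f p := by simpa using hle 0 (zero_mem_coneOf v)
  refine ⟨-(f : (Fin d → ℝ) →ₗ[ℝ] ℝ), ?_, fun i => ?_, by simpa using hp0⟩
  · intro h0
    obtain ⟨a, ha⟩ := hne
    have hz : ∀ x, f x = 0 := fun x => by simpa using DFunLike.congr_fun h0 x
    simpa [hz] using hf a ha
  · by_contra! hi
    have hi' : 0 < f (v i) := by simpa using hi
    have := hle _ (smul_mem_coneOf (t := (f p + 1) / f (v i)) (by positivity) (mem_coneOf v i))
    rw [map_smul, smul_eq_mul, div_mul_cancel₀ _ hi'.ne'] at this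
    linarith

/-- A point in the kernel half-space of a facet is moved into the cone by a large multiple of the
sum of the generators on that facet. -/
lemma exists_add_nsmul_sum_mem_coneOf {m : Module.Dual ℝ (Fin d → ℝ)} (hm0 : ∃ i, 0 < m (v i))
    (S : Finset (Fin s)) (hS : LinearMap.ker m = Submodule.span ℝ (v '' S)) {x : Fin d → ℝ}
    (hx : 0 ≤ m x) : ∃ N : ℕ, x + N • ∑ i ∈ S, v i ∈ coneOf v := by
  obtain ⟨j, hj⟩ := hm0
  have hker : x - (m x / m (v j)) • v j ∈ LinearMap.ker m := by simp [hj.ne']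
  rw [hS, Submodule.mem_span_image_finset_iff_exists_fun'] at hker
  obtain ⟨c, hc⟩ := hker
  obtain ⟨N, hN⟩ := exists_nat_ge (∑ i ∈ S, |c i|)
  refine ⟨N, ?_⟩
  have hsum : x + N • ∑ i ∈ S, v i = (m x / m (v j)) • v j + ∑ i ∈ S, (c i + N) • v i := by
    simp only [add_smul, Finset.sum_add_distrib, hc, Finset.smul_sum, Nat.cast_smul_eq_nsmul]
    abel
  rw [hsum]
  refine add_mem_coneOf (smul_mem_coneOf (div_nonneg hx hj.le) (mem_coneOf v j))
    (sum_smul_mem_coneOf S fun i hi => ?_)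
  have h1 := Finset.single_le_sum (f := fun i => |c i|) (fun i _ => abs_nonneg _) hi
  have h2 := neg_abs_le (c i)
  linarith

end coneOf

/-- for a full-dimensional strongly convex rational polyhedral cone
`C = σ^∨` and a point `λ` of the refined lattice `(1/n)ℤ^d`, `λ` avoids every
translate `C - f` by a `(1/n)`-lattice point `f` of a facet of `C` iff
`-λ ∈ Int C`. -/
theorem ishida_last_map_image
    {d s : ℕ} (g : Fin s → Fin d → ℤ)
    (C : Set (Fin d → ℝ)) (hC : C = coneOf fun i => zCast (g i))
    (hsc : C ∩ (-C) = {0}) (hfd : Submodule.span ℝ C = ⊤)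
    (n : ℕ) (hn : 0 < n)
    (lam : Fin d → ℝ) (hlam : ∀ i, ∃ z : ℤ, lam i = (z : ℝ) / n) :
    (¬ ∃ F : Set (Fin d → ℝ), IsFacetOf F C ∧
        ∃ f ∈ F, (∀ i, ∃ z : ℤ, f i = (z : ℝ) / n) ∧ lam + f ∈ C) ↔
      -lam ∈ interior C := by
  subst hC
  set v : Fin s → Fin d → ℝ := fun i => zCast (g i) with hv
  constructor
  · intro h
    by_contra hint
    refine h ?_
    obtain ⟨m, hm0, hm, hmp, hker⟩ := exists_nonneg_ker_eq_span v (by rw [← span_coneOf, hfd])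
      (-lam) (exists_supporting_of_notMem_interior_coneOf hfd hint)
    obtain ⟨u, hu⟩ := exists_dotR_eq m
    have hpos : ∃ i, 0 < m (v i) := by
      by_contra! hcon
      refine hm0 (LinearMap.ext_on_range ((span_coneOf v).symm.trans hfd) fun i => ?_)
      simpa using le_antisymm (hcon i) (hm i)
    set S : Finset (Fin s) := {i | m (v i) = 0} with hS
    have hker' : LinearMap.ker m = Submodule.span ℝ (v '' S) := by simpa [hS] using hker
    obtain ⟨N, hN⟩ := exists_add_nsmul_sum_mem_coneOf hpos S hker' (x := lam) (by simpa using hmp)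
    have hspan : Submodule.span ℝ {x ∈ coneOf v | dotR u x = 0} = LinearMap.ker m := by
      refine le_antisymm (Submodule.span_le.mpr fun x hx => ?_) ?_
      · simpa [hu] using hx.2
      · rw [hker]
        refine Submodule.span_mono ?_
        rintro _ ⟨i, hi, rfl⟩
        exact ⟨mem_coneOf v i, (hu _).trans hi⟩
    refine ⟨{x ∈ coneOf v | dotR u x = 0}, ⟨⟨u, ?_, fun x hx => ?_, rfl⟩, ?_⟩,
      N • ∑ i ∈ S, v i, ⟨?_, ?_⟩, fun k => ⟨n * (N * ∑ i ∈ S, g i k), ?_⟩, hN⟩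
    · rintro rfl
      exact hm0 (LinearMap.ext fun x => by simp [← hu, dotR])
    · rw [hu]
      exact nonneg_of_mem_coneOf hm hx
    · rw [hspan]
      have h1 := Module.Dual.finrank_ker_add_one_of_ne_zero hm0
      rw [Module.finrank_fin_fun] at h1
      omega
    · rw [← Nat.cast_smul_eq_nsmul ℝ]
      refine smul_mem_coneOf N.cast_nonneg ?_
      simpa using sum_smul_mem_coneOf (v := v) S (c := 1) (by simp)
    · rw [hu, map_nsmul, map_sum, Finset.sum_eq_zero fun i hi => ?_, smul_zero]
      simpa [hS] using hi
    · have : (n : ℝ) ≠ 0 := by positivity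
      simp [hv, zCast]
      field_simp
  · rintro hint ⟨F, ⟨⟨m, hm0, hm, rfl⟩, -⟩, f, ⟨-, hf⟩, -, hmem⟩
    have h1 := dotR_pos_of_mem_interior hm0 hm hint
    have h2 := hm _ hmem
    simp only [dotR_eq_dotProduct, dotProduct_neg, dotProduct_add] at h1 h2 hf
    linarith
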